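/- Let A ∈ ℝ^{m×n} (m < n) and M ∈ ℝ^{m×q} (m ≤ q) with rank(A) = rank(M) = m, let y ∈ ℝ^m, τ ≥ 0 and α ∈ [0,1], and suppose Aᵀ satisfies the weak RSP of order k. Then there exists a constant γ > 0, depending only on (A, M, y, τ, α), such that for every x ∈ ℝⁿ there exists an optimal solution x* of the Dantzig selector problem min{‖z‖₁ : α‖Mᵀ(Az − y)‖_∞ + (1−α)‖Mᵀ(Az − y)‖₁ ≤ τ} satisfying ‖x − x*‖₂ ≤ γ·{ (α‖ϑ‖_∞ + (1−α)‖ϑ‖₁ − τ)⁺ + 2σ_k(x)₁ + c(τ + ‖ϑ‖_∞) }, where ϑ = Mᵀ(Ax − y). In particular, if x satisfies α‖ϑ‖_∞ + (1−α)‖ϑ‖₁ ≤ τ, then ‖x − x*‖₂ ≤ γ·{ 2σ_k(x)₁ + cτ + c‖ϑ‖_∞ } ≤ 2γ·{ σ_k(x)₁ + cτ }. -/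

import Mathlib

open Matrix
open scoped Classical

/-- The ℓ₁ norm on `Fin n → ℝ`. -/
noncomputable def l1norm {n : ℕ} (x : Fin n → ℝ) : ℝ := ∑ i, |x i|

/-- The Euclidean (ℓ₂) norm on `Fin n → ℝ`. -/
noncomputable def l2norm {n : ℕ} (x : Fin n → ℝ) : ℝ := Real.sqrt (∑ i, (x i) ^ 2)

/-- The ℓ_∞ norm on `Fin n → ℝ`. -/
noncomputable def linfnorm {n : ℕ} (x : Fin n → ℝ) : ℝ := ⨆ i, |x i|

/-- The best `k`-term approximation error `σ_k(x)₁`. -/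
noncomputable def bestKTerm {n : ℕ} (k : ℕ) (x : Fin n → ℝ) : ℝ :=
  sInf {t : ℝ | ∃ u : Fin n → ℝ,
    (Finset.univ.filter (fun i => u i ≠ 0)).card ≤ k ∧ t = l1norm (x - u)}

/-- `Aᵀ` satisfies the weak range space property of order `k`. -/
def WeakRSP {m n : ℕ} (A : Matrix (Fin m) (Fin n) ℝ) (k : ℕ) : Prop :=
  ∀ S₁ S₂ : Finset (Fin n), Disjoint S₁ S₂ → S₁.card + S₂.card ≤ k →
    ∃ u : Fin m → ℝ,
      (∀ i ∈ S₁, Aᵀ.mulVec u i = 1) ∧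
      (∀ i ∈ S₂, Aᵀ.mulVec u i = -1) ∧
      (∀ i, i ∉ S₁ → i ∉ S₂ → |Aᵀ.mulVec u i| ≤ 1)

/-- The induced `∞→1` operator norm `‖Q‖_{∞→1} = max_{‖x‖_∞ ≤ 1} ‖Qx‖₁`. -/
noncomputable def opNormInfToOne {a b : ℕ} (Q : Matrix (Fin a) (Fin b) ℝ) : ℝ :=
  sSup {t : ℝ | ∃ x : Fin b → ℝ, linfnorm x ≤ 1 ∧ t = l1norm (Q.mulVec x)}

/-- The constant `c = max {‖M_G⁻¹ (AAᵀ)⁻¹ A‖_{∞→1} : M_G an invertible m×m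
column-submatrix of M}`. -/
noncomputable def cConst {m n q : ℕ} (M : Matrix (Fin m) (Fin q) ℝ)
    (A : Matrix (Fin m) (Fin n) ℝ) : ℝ :=
  sSup {t : ℝ | ∃ g : Fin m → Fin q, Function.Injective g ∧
    IsUnit (M.submatrix id g) ∧
    t = opNormInfToOne ((M.submatrix id g)⁻¹ * (A * Aᵀ)⁻¹ * A)}

/-- The residual `ϑ(x) = Mᵀ(Ax − y)`. -/
noncomputable def resid {m n q : ℕ} (A : Matrix (Fin m) (Fin n) ℝ)
    (M : Matrix (Fin m) (Fin q) ℝ) (y : Fin m → ℝ) (x : Fin n → ℝ) : Fin q → ℝ :=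
  Mᵀ.mulVec (A.mulVec x - y)

/-- A vector in the polar of a finitely generated dual cone is controlled by the positive parts of
its pairings with the generators. -/
theorem exists_norm_le_sum_posPart {E ι : Type*} [NormedAddCommGroup E] [InnerProductSpace ℝ E]
    [FiniteDimensional ℝ E] (a : ι → E) (I : Finset ι) :
    ∃ C : ℝ, 0 ≤ C ∧ ∀ d : E,
      (∀ v : E, (∀ i ∈ I, inner ℝ (a i) v ≤ 0) → inner ℝ d v ≤ 0) →
        ‖d‖ ≤ C * ∑ i ∈ I, max (inner ℝ (a i) d) 0 := by
  set D : Set E := {d | ∀ v : E, (∀ i ∈ I, inner ℝ (a i) v ≤ 0) → inner ℝ d v ≤ 0} with hD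
  have hDc : IsClosed D := by
    simp only [hD, Set.ofPred_forall]
    refine isClosed_iInter fun v => isClosed_iInter fun _ => ?_
    exact isClosed_le (by fun_prop) continuous_const
  have hK : IsCompact (Metric.sphere (0 : E) 1 ∩ D) := (isCompact_sphere 0 1).inter_right hDc
  have hpos : ∀ d ∈ Metric.sphere (0 : E) 1 ∩ D,
      0 < ∑ i ∈ I, max (inner ℝ (a i) d) 0 := by
    rintro d ⟨hd1, hd⟩
    by_contra! hle
    have h0 : ∀ i ∈ I, max (inner ℝ (a i) d) 0 = 0 :=
      (Finset.sum_eq_zero_iff_of_nonneg fun i _ => le_max_right _ _).1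
        (le_antisymm hle (Finset.sum_nonneg fun i _ => le_max_right _ _))
    have h1 := hd d fun i hi => max_eq_right_iff.1 (h0 i hi)
    have h2 : ‖d‖ = 1 := by simpa using hd1
    rw [real_inner_self_eq_norm_sq, h2] at h1
    norm_num at h1
  obtain ⟨c, hc, hcD⟩ := hK.exists_forall_le' (by fun_prop) hpos
  refine ⟨c⁻¹, by positivity, fun d hd => ?_⟩
  rcases eq_or_ne d 0 with rfl | hne
  · simp
  have hn : 0 < ‖d‖ := norm_pos_iff.2 hne
  have hn' : 0 ≤ ‖d‖⁻¹ := by positivity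
  have h := hcD (‖d‖⁻¹ • d) ⟨by simp [norm_smul, hn.ne'], fun v hv => by
    rw [real_inner_smul_left]
    exact mul_nonpos_of_nonneg_of_nonpos hn' (hd v hv)⟩
  have hs : ∑ i ∈ I, max (inner ℝ (a i) (‖d‖⁻¹ • d)) 0
      = ‖d‖⁻¹ * ∑ i ∈ I, max (inner ℝ (a i) d) 0 := by
    rw [Finset.mul_sum]
    refine Finset.sum_congr rfl fun i _ => ?_
    rw [real_inner_smul_right, mul_max_of_nonneg _ _ hn', mul_zero]
  rw [hs] at h
  rw [inv_mul_eq_div, le_div_iff₀ hn] at h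
  rw [inv_mul_eq_div, le_div_iff₀ hc]
  linarith

/-- **Hoffman's error bound** for finite systems of linear inequalities. -/
theorem hoffman_error_bound {E ι : Type*} [NormedAddCommGroup E] [InnerProductSpace ℝ E]
    [FiniteDimensional ℝ E] [Fintype ι] (a : ι → E) :
    ∃ γ : ℝ, 0 < γ ∧ ∀ b : ι → ℝ, (∃ z, ∀ i, inner ℝ (a i) z ≤ b i) →
      ∀ (x : E) (t : ℝ), 0 ≤ t → (∀ i, inner ℝ (a i) x ≤ b i + t) →
        ∃ p, (∀ i, inner ℝ (a i) p ≤ b i) ∧ ‖x - p‖ ≤ γ * t := by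
  choose C hC0 hC using exists_norm_le_sum_posPart a
  refine ⟨∑ I : Finset ι, C I * I.card + 1, ?_, ?_⟩
  · have : 0 ≤ ∑ I : Finset ι, C I * I.card :=
      Finset.sum_nonneg fun I _ => mul_nonneg (hC0 I) (Nat.cast_nonneg _)
    linarith
  intro b hne x t ht hx
  set P : Set E := {z | ∀ i, inner ℝ (a i) z ≤ b i} with hP
  have hPc : IsClosed P := by
    simp only [hP, Set.ofPred_forall]
    exact isClosed_iInter fun i => isClosed_le (by fun_prop) continuous_const
  have hPconv : Convex ℝ P := by
    simp only [hP, Set.ofPred_forall]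
    exact convex_iInter fun i => convex_halfSpace_le (innerₛₗ ℝ (a i)).isLinear (b i)
  have hPne : P.Nonempty := hne
  obtain ⟨p, hp, hpx⟩ := exists_norm_eq_iInf_of_complete_convex hPne hPc.isComplete hPconv x
  rw [norm_eq_iInf_iff_real_inner_le_zero hPconv hp] at hpx
  refine ⟨p, hp, ?_⟩
  set I : Finset ι := Finset.univ.filter fun i => inner ℝ (a i) p = b i with hI
  have hpolar : ∀ v : E, (∀ i ∈ I, inner ℝ (a i) v ≤ 0) → inner ℝ (x - p) v ≤ 0 := by
    intro v hv
    have hev : ∀ᶠ ε in nhdsWithin (0 : ℝ) (Set.Ioi 0), ∀ i, inner ℝ (a i) (p + ε • v) ≤ b i := by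
      rw [Filter.eventually_all]
      intro i
      by_cases hi : inner ℝ (a i) p = b i
      · filter_upwards [self_mem_nhdsWithin] with ε hε
        have := hv i (by simp [hI, hi])
        rw [inner_add_right, real_inner_smul_right, hi]
        have := mul_nonpos_of_nonneg_of_nonpos (le_of_lt hε) this
        linarith
      · have hlt : inner ℝ (a i) (p + (0 : ℝ) • v) < b i := by
          simpa using lt_of_le_of_ne (hp i) hi
        have hcont : Continuous fun ε : ℝ => inner ℝ (a i) (p + ε • v) := by fun_prop
        have := (hcont.tendsto 0).eventually_lt_const hlt
        exact (this.filter_mono nhdsWithin_le_nhds).mono fun _ h => le_of_lt h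
    obtain ⟨ε, hε, hε0⟩ := (hev.and self_mem_nhdsWithin).exists
    have h := hpx _ hε
    rw [add_sub_cancel_left, real_inner_smul_right] at h
    exact nonpos_of_mul_nonpos_right h hε0
  have h1 : ∑ i ∈ I, max (inner ℝ (a i) (x - p)) 0 ≤ I.card * t := by
    rw [← nsmul_eq_mul]
    refine Finset.sum_le_card_nsmul _ _ _ fun i hi => max_le ?_ ht
    have : inner ℝ (a i) p = b i := by simpa [hI] using hi
    rw [inner_sub_right, this]
    linarith [hx i]
  have h2 : C I * I.card ≤ ∑ I : Finset ι, C I * I.card :=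
    Finset.single_le_sum (f := fun I : Finset ι => C I * (I.card : ℝ))
      (fun J _ => mul_nonneg (hC0 J) (Nat.cast_nonneg _)) (Finset.mem_univ I)
  calc ‖x - p‖ ≤ C I * ∑ i ∈ I, max (inner ℝ (a i) (x - p)) 0 := hC I _ hpolar
    _ ≤ C I * (I.card * t) := mul_le_mul_of_nonneg_left h1 (hC0 I)
    _ = (C I * I.card) * t := by ring
    _ ≤ _ := mul_le_mul_of_nonneg_right (by linarith) ht

theorem abs_le_linfnorm {n : ℕ} (x : Fin n → ℝ) (i : Fin n) : |x i| ≤ linfnorm x :=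
  le_ciSup (f := fun i => |x i|) (Set.finite_range _).bddAbove i

theorem linfnorm_nonneg {n : ℕ} (x : Fin n → ℝ) : 0 ≤ linfnorm x :=
  Real.iSup_nonneg fun _ => abs_nonneg _

theorem linfnorm_le {n : ℕ} {x : Fin n → ℝ} {t : ℝ} (ht : 0 ≤ t) (h : ∀ i, |x i| ≤ t) :
    linfnorm x ≤ t :=
  Real.iSup_le h ht

theorem l1norm_nonneg {n : ℕ} (x : Fin n → ℝ) : 0 ≤ l1norm x :=
  Finset.sum_nonneg fun _ _ => abs_nonneg _

theorem linfnorm_le_l1norm {n : ℕ} (x : Fin n → ℝ) : linfnorm x ≤ l1norm x :=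
  linfnorm_le (l1norm_nonneg x) fun i =>
    Finset.single_le_sum (f := fun i => |x i|) (fun _ _ => abs_nonneg _) (Finset.mem_univ i)

theorem dotProduct_le_l1norm_mul {n : ℕ} (w v : Fin n → ℝ) {t : ℝ} (h : ∀ i, |v i| ≤ t) :
    w ⬝ᵥ v ≤ l1norm w * t := by
  rw [dotProduct, l1norm, Finset.sum_mul]
  refine Finset.sum_le_sum fun i _ => (le_abs_self _).trans ?_
  rw [abs_mul]
  exact mul_le_mul_of_nonneg_left (h i) (abs_nonneg _)

theorem signType_mul_le_abs (s : SignType) (r : ℝ) : (s : ℝ) * r ≤ |r| := by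
  cases s <;> simp [le_abs_self, neg_le_abs]

theorem l1norm_le_iff {n : ℕ} (x : Fin n → ℝ) (t : ℝ) :
    l1norm x ≤ t ↔ ∀ s : Fin n → SignType, ∑ i, (s i : ℝ) * x i ≤ t := by
  refine ⟨fun h s => (Finset.sum_le_sum fun i _ => signType_mul_le_abs (s i) (x i)).trans h,
    fun h => ?_⟩
  simpa [l1norm, sign_mul_self] using h fun i => SignType.sign (x i)

/-- The sublevel sets of a convex combination of the ℓ_∞ and ℓ₁ norms are polyhedra. -/
theorem convexComb_norm_le_iff {q : ℕ} (w : Fin q → ℝ) {α t : ℝ} (hα0 : 0 ≤ α) (hα1 : α ≤ 1)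
    (ht : 0 ≤ t) :
    α * linfnorm w + (1 - α) * l1norm w ≤ t ↔
      ∀ j : Fin q × SignType × (Fin q → SignType),
        α * ((j.2.1 : ℝ) * w j.1) + (1 - α) * ∑ i, (j.2.2 i : ℝ) * w i ≤ t := by
  have hα1' : 0 ≤ 1 - α := by linarith
  constructor
  · rintro h ⟨j, e, s⟩
    refine le_trans (add_le_add (mul_le_mul_of_nonneg_left ?_ hα0)
      (mul_le_mul_of_nonneg_left ?_ hα1')) h
    · exact (signType_mul_le_abs e (w j)).trans (abs_le_linfnorm w j)
    · exact (l1norm_le_iff w _).1 le_rfl s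
  · intro h
    rcases q.eq_zero_or_pos with rfl | hq
    · simpa [linfnorm, l1norm] using ht
    have : Nonempty (Fin q) := ⟨⟨0, hq⟩⟩
    obtain ⟨j, hj⟩ := exists_eq_ciSup_of_finite (f := fun i => |w i|)
    have := h (j, SignType.sign (w j), fun i => SignType.sign (w i))
    simp only [sign_mul_self] at this
    rwa [linfnorm, ← hj, l1norm]

theorem mulVec_surjective_of_rank_eq {m n : ℕ} {A : Matrix (Fin m) (Fin n) ℝ} (h : A.rank = m) :
    Function.Surjective A.mulVec := by
  have : LinearMap.range A.mulVecLin = ⊤ :=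
    Submodule.eq_top_of_finrank_eq (by simpa [Matrix.rank] using h)
  exact LinearMap.range_eq_top.1 this

theorem isUnit_mul_transpose_of_rank_eq {m n : ℕ} {A : Matrix (Fin m) (Fin n) ℝ}
    (h : A.rank = m) : IsUnit (A * Aᵀ) :=
  Matrix.mulVec_surjective_iff_isUnit.1
    (mulVec_surjective_of_rank_eq ((Matrix.rank_self_mul_transpose A).trans h))

/-- A matrix of full row rank has an invertible square column submatrix. -/
theorem exists_isUnit_submatrix_of_rank_eq {m q : ℕ} {M : Matrix (Fin m) (Fin q) ℝ}
    (h : M.rank = m) :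
    ∃ g : Fin m → Fin q, Function.Injective g ∧ IsUnit (M.submatrix id g) := by
  rw [Matrix.rank_eq_finrank_span_cols] at h
  obtain ⟨f, hf, -, hli⟩ := Submodule.exists_fun_fin_finrank_span_eq ℝ (Set.range M.col)
  choose g hg using hf
  set e := finCongr h.symm
  have hcol : (M.submatrix id (g ∘ e)).col = f ∘ e := by
    funext i
    exact hg (e i)
  refine ⟨g ∘ e, ?_, ?_⟩
  · refine Function.Injective.of_comp (f := M.col) ?_
    rw [show M.col ∘ g ∘ e = f ∘ e from funext fun i => hg (e i)]
    exact hli.injective.comp e.injective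
  · rw [← Matrix.linearIndependent_cols_iff_isUnit, hcol]
    exact hli.comp e e.injective

theorem bddAbove_opNormInfToOne {a b : ℕ} (Q : Matrix (Fin a) (Fin b) ℝ) :
    BddAbove {t : ℝ | ∃ x : Fin b → ℝ, linfnorm x ≤ 1 ∧ t = l1norm (Q.mulVec x)} := by
  refine ⟨∑ i, l1norm (Q i), ?_⟩
  rintro _ ⟨x, hx, rfl⟩
  have hx' : ∀ i, |x i| ≤ 1 := fun i => (abs_le_linfnorm x i).trans hx
  refine Finset.sum_le_sum fun i _ => abs_le.2 ⟨?_, ?_⟩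
  · have := dotProduct_le_l1norm_mul (Q i) (-x) (t := 1) (by simpa using hx')
    rw [dotProduct_neg, mul_one] at this
    simp only [mulVec]
    linarith
  · exact (dotProduct_le_l1norm_mul (Q i) x hx').trans_eq (mul_one _)

theorem l1norm_mulVec_le_cConst {m n q : ℕ} (M : Matrix (Fin m) (Fin q) ℝ)
    (A : Matrix (Fin m) (Fin n) ℝ) {g : Fin m → Fin q} (hg : Function.Injective g)
    (hgu : IsUnit (M.submatrix id g)) {ζ : Fin n → ℝ} (hζ : linfnorm ζ ≤ 1) :
    l1norm (((M.submatrix id g)⁻¹ * (A * Aᵀ)⁻¹ * A).mulVec ζ) ≤ cConst M A := by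
  refine (le_csSup (bddAbove_opNormInfToOne _) ⟨ζ, hζ, rfl⟩).trans ?_
  refine le_csSup (Set.Finite.bddAbove ?_) ⟨g, hg, hgu, rfl⟩
  refine (Set.finite_range fun g : Fin m → Fin q =>
    opNormInfToOne ((M.submatrix id g)⁻¹ * (A * Aᵀ)⁻¹ * A)).subset ?_
  rintro _ ⟨g, -, -, rfl⟩
  exact ⟨g, rfl⟩

theorem cConst_nonneg {m n q : ℕ} (M : Matrix (Fin m) (Fin q) ℝ)
    (A : Matrix (Fin m) (Fin n) ℝ) : 0 ≤ cConst M A := by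
  refine Real.sSup_nonneg ?_
  rintro _ ⟨g, -, -, rfl⟩
  refine Real.sSup_nonneg ?_
  rintro _ ⟨x, -, rfl⟩
  exact l1norm_nonneg _

theorem bestKTerm_nonneg {n : ℕ} (k : ℕ) (x : Fin n → ℝ) : 0 ≤ bestKTerm k x := by
  refine Real.sInf_nonneg ?_
  rintro _ ⟨u, -, rfl⟩
  exact l1norm_nonneg _

theorem le_bestKTerm {n k : ℕ} {x : Fin n → ℝ} {t : ℝ}
    (h : ∀ u : Fin n → ℝ, (Finset.univ.filter fun i => u i ≠ 0).card ≤ k → t ≤ l1norm (x - u)) :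
    t ≤ bestKTerm k x := by
  refine le_csInf ⟨_, 0, by simp, rfl⟩ ?_
  rintro _ ⟨u, hu, rfl⟩
  exact h u hu

/-- Under the weak range space property, the ℓ₁ norm of `x` exceeds that of `z` by at most twice
the best `k`-term approximation error plus a multiple of the residual difference. -/
theorem l1norm_le_of_weakRSP {m n q k : ℕ} {A : Matrix (Fin m) (Fin n) ℝ}
    {M : Matrix (Fin m) (Fin q) ℝ} (hA : A.rank = m) (hM : M.rank = m) (hRSP : WeakRSP A k)
    (y : Fin m → ℝ) (x z : Fin n → ℝ) :
    l1norm x ≤ l1norm z + 2 * bestKTerm k x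
      + cConst M A * (linfnorm (resid A M y z) + linfnorm (resid A M y x)) := by
  set r := linfnorm (resid A M y z) + linfnorm (resid A M y x) with hr
  have hr0 : 0 ≤ r := add_nonneg (linfnorm_nonneg _) (linfnorm_nonneg _)
  suffices (l1norm x - l1norm z - cConst M A * r) / 2 ≤ bestKTerm k x by linarith
  refine le_bestKTerm fun u hu => ?_
  obtain ⟨g, hg, hgu⟩ := exists_isUnit_submatrix_of_rank_eq hM
  set G := M.submatrix id g with hG
  obtain ⟨v, hv1, hv2, hv3⟩ := hRSP (Finset.univ.filter fun i => u i ≠ 0 ∧ 0 ≤ x i)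
    (Finset.univ.filter fun i => u i ≠ 0 ∧ x i < 0)
    (Finset.disjoint_filter.2 fun i _ h1 h2 => absurd h1.2 (not_le.2 h2.2)) (by
      rw [← Finset.card_union_of_disjoint
        (Finset.disjoint_filter.2 fun i _ h1 h2 => absurd h1.2 (not_le.2 h2.2))]
      refine (Finset.card_le_card ?_).trans hu
      intro i
      simp only [Finset.mem_union, Finset.mem_filter]
      tauto)
  set ζ := Aᵀ.mulVec v with hζ
  have hζle : ∀ i, |ζ i| ≤ 1 := by
    intro i
    by_cases h1 : i ∈ Finset.univ.filter fun i => u i ≠ 0 ∧ 0 ≤ x i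
    · simp [hv1 i h1]
    by_cases h2 : i ∈ Finset.univ.filter fun i => u i ≠ 0 ∧ x i < 0
    · simp [hv2 i h2]
    exact hv3 i h1 h2
  set w := (G⁻¹ * (A * Aᵀ)⁻¹ * A).mulVec ζ with hw
  have hwc : l1norm w ≤ cConst M A :=
    l1norm_mulVec_le_cConst M A hg hgu (linfnorm_le zero_le_one hζle)
  have hGw : G.mulVec w = v := by
    have h1 := (Matrix.isUnit_iff_isUnit_det _).1 hgu
    have h2 := (Matrix.isUnit_iff_isUnit_det _).1 (isUnit_mul_transpose_of_rank_eq hA)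
    rw [hw, hζ, mulVec_mulVec, mulVec_mulVec, Matrix.mul_assoc, Matrix.mul_assoc,
      Matrix.mul_assoc, Matrix.nonsing_inv_mul _ h2, Matrix.mul_one, Matrix.mul_nonsing_inv _ h1,
      one_mulVec]
  have hpair : ζ ⬝ᵥ (x - z) = w ⬝ᵥ fun i => resid A M y x (g i) - resid A M y z (g i) := by
    have h1 : (fun i => resid A M y x (g i) - resid A M y z (g i))
        = Gᵀ.mulVec (A.mulVec (x - z)) := by
      have : A.mulVec (x - z) = (A.mulVec x - y) - (A.mulVec z - y) := by
        rw [mulVec_sub]; abel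
      rw [this, mulVec_sub]
      rfl
    rw [h1, dotProduct_mulVec, vecMul_transpose, hGw, hζ, dotProduct_mulVec, mulVec_transpose]
  have hpairle : ζ ⬝ᵥ (x - z) ≤ cConst M A * r := by
    rw [hpair]
    refine (dotProduct_le_l1norm_mul w _ (t := r) fun i => ?_).trans
      (mul_le_mul_of_nonneg_right hwc hr0)
    refine (abs_sub _ _).trans ?_
    have h1 := abs_le_linfnorm (resid A M y x) (g i)
    have h2 := abs_le_linfnorm (resid A M y z) (g i)
    linarith
  have hz : ζ ⬝ᵥ z ≤ l1norm z := by
    rw [dotProduct_comm]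
    simpa using dotProduct_le_l1norm_mul z ζ hζle
  have hx : l1norm x - 2 * l1norm (x - u) ≤ ζ ⬝ᵥ x := by
    simp only [l1norm, dotProduct, Finset.mul_sum, ← Finset.sum_sub_distrib]
    refine Finset.sum_le_sum fun i _ => ?_
    by_cases hui : u i = 0
    · have h1 : |ζ i * x i| ≤ |x i| := by
        rw [abs_mul]
        exact mul_le_of_le_one_left (abs_nonneg _) (hζle i)
      have h2 := neg_abs_le (ζ i * x i)
      simp only [Pi.sub_apply, hui, sub_zero]
      linarith
    · have h0 := abs_nonneg ((x - u) i)
      rcases le_or_gt 0 (x i) with h | h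
      · rw [hv1 i (by simp [hui, h]), abs_of_nonneg h]
        linarith
      · rw [hv2 i (by simp [hui, h]), abs_of_neg h]
        linarith
  rw [dotProduct_sub] at hpairle
  linarith

theorem continuous_l1norm {n : ℕ} : Continuous (l1norm : (Fin n → ℝ) → ℝ) := by
  unfold l1norm
  fun_prop

/-- The ℓ₁ norm attains its minimum on every nonempty closed set. -/
theorem exists_l1norm_minimizer {n : ℕ} {F : Set (Fin n → ℝ)} (hF : IsClosed F)
    (hne : F.Nonempty) : ∃ z ∈ F, ∀ z' ∈ F, l1norm z ≤ l1norm z' := by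
  obtain ⟨z₀, hz₀⟩ := hne
  have hcoe : Filter.Tendsto (l1norm : (Fin n → ℝ) → ℝ) (Filter.cocompact _) Filter.atTop := by
    refine Filter.tendsto_atTop_mono (fun x => ?_) tendsto_norm_cocompact_atTop
    refine (pi_norm_le_iff_of_nonneg (l1norm_nonneg x)).2 fun i => ?_
    exact (abs_le_linfnorm x i).trans (linfnorm_le_l1norm x)
  obtain ⟨z, hz, hmin⟩ := continuous_l1norm.continuousOn.exists_isMinOn' hF hz₀
    ((hcoe.eventually_ge_atTop (l1norm z₀)).filter_mono inf_le_left)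
  exact ⟨z, hz, fun z' hz' => hmin hz'⟩

/-- Theorem 3.2: stability of the Dantzig selector
`min {‖z‖₁ : α‖Mᵀ(Az−y)‖_∞ + (1−α)‖Mᵀ(Az−y)‖₁ ≤ τ}` under the weak RSP of order `k`. -/
theorem DS_stability_weakRSP (m n q k : ℕ) (hmn : m < n) (hmq : m ≤ q)
    (A : Matrix (Fin m) (Fin n) ℝ) (M : Matrix (Fin m) (Fin q) ℝ)
    (hArank : A.rank = m) (hMrank : M.rank = m)
    (y : Fin m → ℝ) (τ α : ℝ) (hτ : 0 ≤ τ) (hα0 : 0 ≤ α) (hα1 : α ≤ 1)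
    (hRSP : WeakRSP A k) :
    ∃ γ : ℝ, 0 < γ ∧
      ∀ x : Fin n → ℝ, ∃ xstar : Fin n → ℝ,
        (α * linfnorm (resid A M y xstar) + (1 - α) * l1norm (resid A M y xstar) ≤ τ ∧
          ∀ z : Fin n → ℝ,
            α * linfnorm (resid A M y z) + (1 - α) * l1norm (resid A M y z) ≤ τ →
              l1norm xstar ≤ l1norm z) ∧
        l2norm (x - xstar) ≤
          γ * (max (α * linfnorm (resid A M y x) + (1 - α) * l1norm (resid A M y x) - τ) 0
                + 2 * bestKTerm k x
                + cConst M A * (τ + linfnorm (resid A M y x))) ∧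
        (α * linfnorm (resid A M y x) + (1 - α) * l1norm (resid A M y x) ≤ τ →
          l2norm (x - xstar) ≤
            γ * (2 * bestKTerm k x + cConst M A * τ
                  + cConst M A * linfnorm (resid A M y x)) ∧
          l2norm (x - xstar) ≤ 2 * γ * (bestKTerm k x + cConst M A * τ)) := by
  have hα1' : 0 ≤ 1 - α := by linarith
  set J := Fin q × SignType × (Fin q → SignType)
  set B : Matrix (Fin q) (Fin n) ℝ := Mᵀ * A with hB
  -- the functionals cutting out the optimal set
  let coef : J → Fin q → ℝ := fun j i =>
    α * (if i = j.1 then (j.2.1 : ℝ) else 0) + (1 - α) * (j.2.2 i : ℝ)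
  have hcoef : ∀ (j : J) (w : Fin q → ℝ), coef j ⬝ᵥ w =
      α * ((j.2.1 : ℝ) * w j.1) + (1 - α) * ∑ i, (j.2.2 i : ℝ) * w i := by
    intro j w
    simp only [coef, dotProduct, add_mul, Finset.sum_add_distrib, Finset.mul_sum, mul_assoc,
      ite_mul, zero_mul, mul_ite, mul_zero, Finset.sum_ite_eq',
      Finset.mem_univ, if_true]
  let a : (Fin n → SignType) ⊕ J → EuclideanSpace ℝ (Fin n) :=
    Sum.elim (fun s => WithLp.toLp 2 fun i => (s i : ℝ))
      (fun j => WithLp.toLp 2 (coef j ᵥ* B))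
  have ha1 : ∀ s (z : Fin n → ℝ),
      inner ℝ (a (.inl s)) (WithLp.toLp 2 z) = ∑ i, (s i : ℝ) * z i := by
    intro s z
    simp [a, PiLp.inner_apply, mul_comm]
  have ha2 : ∀ j (z : Fin n → ℝ), inner ℝ (a (.inr j)) (WithLp.toLp 2 z)
      = coef j ⬝ᵥ resid A M y z + coef j ⬝ᵥ Mᵀ.mulVec y := by
    intro j z
    have h1 : resid A M y z = B.mulVec z - Mᵀ.mulVec y := by
      rw [resid, mulVec_sub, mulVec_mulVec]
    rw [h1, dotProduct_sub, sub_add_cancel, dotProduct_mulVec]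
    simp [a, PiLp.inner_apply, dotProduct, mul_comm]
  have hfeas : ∀ (z : Fin n → ℝ) (t : ℝ), 0 ≤ t →
      (α * linfnorm (resid A M y z) + (1 - α) * l1norm (resid A M y z) ≤ t ↔
        ∀ j, inner ℝ (a (.inr j)) (WithLp.toLp 2 z) ≤ t + coef j ⬝ᵥ Mᵀ.mulVec y) := by
    intro z t ht
    rw [convexComb_norm_le_iff _ hα0 hα1 ht]
    simp only [ha2, hcoef, add_le_add_iff_right]
    rfl
  obtain ⟨γ, hγ, hH⟩ := hoffman_error_bound a
  obtain ⟨zopt, hzopt, hmin⟩ : ∃ z ∈ {z | α * linfnorm (resid A M y z)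
      + (1 - α) * l1norm (resid A M y z) ≤ τ}, ∀ z' ∈ {z | α * linfnorm (resid A M y z)
      + (1 - α) * l1norm (resid A M y z) ≤ τ}, l1norm z ≤ l1norm z' := by
    refine exists_l1norm_minimizer ?_ ?_
    · simp only [hfeas _ τ hτ, Set.ofPred_forall]
      exact isClosed_iInter fun j => isClosed_le (by fun_prop) continuous_const
    · obtain ⟨z, hz⟩ := mulVec_surjective_of_rank_eq hArank y
      refine ⟨z, ?_⟩
      have h0 : resid A M y z = 0 := by simp [resid, hz]
      simpa [h0, linfnorm, l1norm] using hτ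
  have hres : linfnorm (resid A M y zopt) ≤ τ := by
    have h1 := mul_le_mul_of_nonneg_left (linfnorm_le_l1norm (resid A M y zopt)) hα1'
    have h2 : α * linfnorm (resid A M y zopt) + (1 - α) * l1norm (resid A M y zopt) ≤ τ := hzopt
    linarith
  have hc := cConst_nonneg M A
  refine ⟨γ, hγ, fun x => ?_⟩
  have hϑ := linfnorm_nonneg (resid A M y x)
  have hσ := bestKTerm_nonneg k x
  set V := α * linfnorm (resid A M y x) + (1 - α) * l1norm (resid A M y x) with hV
  set T := max (V - τ) 0 + 2 * bestKTerm k x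
    + cConst M A * (τ + linfnorm (resid A M y x)) with hT
  have hmax0 : 0 ≤ max (V - τ) 0 := le_max_right _ _
  have hcr : 0 ≤ cConst M A * (τ + linfnorm (resid A M y x)) := by positivity
  have hT0 : 0 ≤ T := by positivity
  have hxT : l1norm x ≤ l1norm zopt + T := by
    have h1 := l1norm_le_of_weakRSP hArank hMrank hRSP y x zopt
    have h2 := mul_le_mul_of_nonneg_left
      (add_le_add_left hres (linfnorm (resid A M y x))) hc
    linarith
  have hVT : V ≤ τ + T := by
    have := le_max_left (V - τ) 0
    linarith
  obtain ⟨p, hp, hpx⟩ := hH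
    (Sum.elim (fun _ => l1norm zopt) (fun j => τ + coef j ⬝ᵥ Mᵀ.mulVec y))
    ⟨WithLp.toLp 2 zopt, by
      rintro (s | j)
      · simpa [ha1] using (l1norm_le_iff zopt _).1 le_rfl s
      · exact (hfeas zopt τ hτ).1 hzopt j⟩
    (WithLp.toLp 2 x) T hT0 (by
      rintro (s | j)
      · simpa [ha1] using (l1norm_le_iff x _).1 hxT s
      · have := (hfeas x (τ + T) (by linarith)).1 hVT j
        simp only [Sum.elim_inr]
        linarith)
  have hp1 : l1norm p.ofLp ≤ l1norm zopt :=
    (l1norm_le_iff _ _).2 fun s => (ha1 s p.ofLp).symm.le.trans (hp (.inl s))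
  have hdist : l2norm (x - p.ofLp) ≤ γ * T := by
    simpa [l2norm, EuclideanSpace.norm_eq] using hpx
  refine ⟨p.ofLp, ⟨(hfeas _ τ hτ).2 fun j => hp (.inr j), fun z hz => hp1.trans (hmin z hz)⟩,
    hdist, fun hVτ => ?_⟩
  have hT' : T = 2 * bestKTerm k x + cConst M A * τ + cConst M A * linfnorm (resid A M y x) := by
    rw [hT, max_eq_right (by linarith)]
    ring
  refine ⟨hT' ▸ hdist, hdist.trans ?_⟩
  have hϑτ : linfnorm (resid A M y x) ≤ τ := by
    have h1 := mul_le_mul_of_nonneg_left (linfnorm_le_l1norm (resid A M y x)) hα1'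
    linarith
  have h2 := mul_le_mul_of_nonneg_left hϑτ hc
  have h3 : T ≤ 2 * (bestKTerm k x + cConst M A * τ) := by linarith
  calc γ * T ≤ γ * (2 * (bestKTerm k x + cConst M A * τ)) := mul_le_mul_of_nonneg_left h3 hγ.le
    _ = _ := by ring
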